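/- For all 1 ≤ n ≤ L−1, the following identity of rational functions holds: Sym[C(n) · (t_{L−1}^{(1)})^{−1} f_n^{x}(t^{(1)}) · (t_{L−1}^{(2)})^{−1} f_0(t^{(2)})] = Sym[((x−1) t_{L−1}^{(1)} t_{L−1}^{(2)})^{−1} f_n^{x}(t^{(1)}) (−(1 + δ_{n,1}) f_0(t^{(2)}) + x Σ_{m=1}^{L−1} f_m^{x}(t^{(2)}))] + δ_{n,1} · Sym[((x−1) t_{L−1}^{(1)} t_{L−1}^{(2)})^{−1} f_0(t^{(2)}) (f_0(t^{(1)}) − x Σ_{m=2}^{L−1} f_m^{x}(t^{(1)}))]. -/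

import Mathlib

noncomputable section

open Finset

/-- `f₀(t^{(a)})`, with the convention `t₀^{(a)} = u 0 a` (hypothesised to be `1`). -/
def f0 (L : ℕ) (u : ℕ → ℕ → ℂ) (a : ℕ) : ℂ :=
  ∏ m ∈ Finset.Icc 1 (L - 1), (u (m - 1) a - u m a)⁻¹

/-- `f_n^v(t^{(a)})` for a parameter `v ∈ {x, y}`. -/
def fP (L : ℕ) (v : ℂ) (n : ℕ) (u : ℕ → ℕ → ℂ) (a : ℕ) : ℂ :=
  (1 - v * u (L - 1) a)⁻¹ *
    ∏ m ∈ (Finset.Icc 1 (L - 1)).erase n, (u (m - 1) a - u m a)⁻¹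

/-- `f_{l,k}^v(t^{(a)})`. -/
def fP2 (L : ℕ) (v : ℂ) (l k : ℕ) (u : ℕ → ℕ → ℂ) (a : ℕ) : ℂ :=
  (1 - v * u (L - 1) a)⁻¹ *
    ∏ m ∈ ((Finset.Icc 1 (L - 1)).erase l).erase k, (u (m - 1) a - u m a)⁻¹

/-- The family `t` with the variables `t m 1 ↔ t m 2` swapped for `m ∈ S`. -/
def swapOn (S : Finset ℕ) (t : ℕ → ℕ → ℂ) : ℕ → ℕ → ℂ :=
  fun m a => if m ∈ S then t m (3 - a) else t m a

/-- The symmetrisation over the group `(S₂)^{L-1}`: the sum of the values of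
`g` on all families obtained from `t` by swapping `t m 1 ↔ t m 2` for `m` in a
subset of `{1, …, L-1}`. -/
def symSum (L : ℕ) (t : ℕ → ℕ → ℂ) (g : (ℕ → ℕ → ℂ) → ℂ) : ℂ :=
  ∑ S ∈ (Finset.Icc 1 (L - 1)).powerset, g (swapOn S t)

/-- The factor `C(n)`. -/
def Cf (L n : ℕ) (u : ℕ → ℕ → ℂ) : ℂ :=
  (∑ m ∈ Finset.Icc n (L - 1),
      u m 1 * (-(u m 1 - u (m - 1) 2)⁻¹ + 2 * (u m 1 - u m 2)⁻¹))
  - (∑ m ∈ Finset.Icc n (L - 2), u m 1 * (u m 1 - u (m + 1) 2)⁻¹)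
  + (if n = 1 then u 1 1 * (u 1 1 - 1)⁻¹ else 0)

/-- The part of `C(n)` without the `δ` term, for top level `K`. -/
def Cp (n K : ℕ) (u : ℕ → ℕ → ℂ) : ℂ :=
  (∑ m ∈ Finset.Icc n K,
      u m 1 * (-(u m 1 - u (m - 1) 2)⁻¹ + 2 * (u m 1 - u m 2)⁻¹))
  - (∑ m ∈ Finset.Ico n K, u m 1 * (u m 1 - u (m + 1) 2)⁻¹)

/-- Full product. -/
def PP (K : ℕ) (u : ℕ → ℕ → ℂ) : ℂ :=
  ∏ m ∈ Finset.Icc 1 K, ((u (m - 1) 1 - u m 1)⁻¹ * (u (m - 1) 2 - u m 2)⁻¹)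

/-- Product with one factor removed. -/
def GG (n K : ℕ) (u : ℕ → ℕ → ℂ) : ℂ :=
  (u (n - 1) 1 - u n 1) * PP K u

lemma Cp_congr (n K : ℕ) (u v : ℕ → ℕ → ℂ) (h : ∀ m ≤ K, u m = v m) :
    Cp n K u = Cp n K v := by
  unfold Cp
  congr 1
  · refine Finset.sum_congr rfl fun m hm => ?_
    rw [Finset.mem_Icc] at hm
    rw [h m (by omega), h (m - 1) (by omega)]
  · refine Finset.sum_congr rfl fun m hm => ?_
    rw [Finset.mem_Ico] at hm
    rw [h m (by omega), h (m + 1) (by omega)]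

lemma PP_congr (K : ℕ) (u v : ℕ → ℕ → ℂ) (h : ∀ m ≤ K, u m = v m) :
    PP K u = PP K v := by
  unfold PP
  refine Finset.prod_congr rfl fun m hm => ?_
  rw [Finset.mem_Icc] at hm
  rw [h m (by omega), h (m - 1) (by omega)]

lemma GG_congr (n K : ℕ) (hn : n ≤ K) (u v : ℕ → ℕ → ℂ) (h : ∀ m ≤ K, u m = v m) :
    GG n K u = GG n K v := by
  unfold GG
  rw [PP_congr K u v h, h n hn, h (n - 1) (by omega)]

lemma PP_succ (K : ℕ) (u : ℕ → ℕ → ℂ) :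
    PP (K + 1) u = PP K u *
      ((u K 1 - u (K + 1) 1)⁻¹ * (u K 2 - u (K + 1) 2)⁻¹) := by
  unfold PP
  rw [Finset.prod_Icc_succ_top (by omega)]
  simp

lemma GG_succ (n K : ℕ) (u : ℕ → ℕ → ℂ) :
    GG n (K + 1) u = GG n K u *
      ((u K 1 - u (K + 1) 1)⁻¹ * (u K 2 - u (K + 1) 2)⁻¹) := by
  unfold GG
  rw [PP_succ]
  ring

lemma Cp_succ (n K : ℕ) (hn : n ≤ K) (u : ℕ → ℕ → ℂ) :
    Cp n (K + 1) u = Cp n K u +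
      (u (K + 1) 1 * (-(u (K + 1) 1 - u K 2)⁻¹ + 2 * (u (K + 1) 1 - u (K + 1) 2)⁻¹)
       - u K 1 * (u K 1 - u (K + 1) 2)⁻¹) := by
  unfold Cp
  rw [Finset.sum_Icc_succ_top (by omega), Finset.sum_Ico_succ_top hn]
  simp only [Nat.add_sub_cancel]
  ring

lemma Cp_self (n : ℕ) (u : ℕ → ℕ → ℂ) :
    Cp n n u = u n 1 * (-(u n 1 - u (n - 1) 2)⁻¹ + 2 * (u n 1 - u n 2)⁻¹) := by
  simp [Cp]

lemma swapOn_or (S : Finset ℕ) (t : ℕ → ℕ → ℂ) (m : ℕ) :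
    (swapOn S t m 1 = t m 1 ∧ swapOn S t m 2 = t m 2) ∨
    (swapOn S t m 1 = t m 2 ∧ swapOn S t m 2 = t m 1) := by
  by_cases h : m ∈ S <;> simp [swapOn, h]

lemma swapOn_insert (K : ℕ) (S : Finset ℕ) (hS : S ⊆ Finset.Icc 1 K) (t : ℕ → ℕ → ℂ) :
    (∀ m ≤ K, swapOn (insert (K + 1) S) t m = swapOn S t m) ∧
    swapOn (insert (K + 1) S) t (K + 1) 1 = t (K + 1) 2 ∧
    swapOn (insert (K + 1) S) t (K + 1) 2 = t (K + 1) 1 ∧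
    swapOn S t (K + 1) 1 = t (K + 1) 1 ∧
    swapOn S t (K + 1) 2 = t (K + 1) 2 := by
  have hK : K + 1 ∉ S := fun h => by
    have := hS h
    rw [Finset.mem_Icc] at this
    omega
  refine ⟨fun m hm => ?_, ?_, ?_, ?_, ?_⟩
  · funext a
    have : m ≠ K + 1 := by omega
    simp [swapOn, this]
  all_goals simp [swapOn, hK]

lemma sum_split (K : ℕ) (g : Finset ℕ → ℂ) :
    ∑ S ∈ (Finset.Icc 1 (K + 1)).powerset, g S =
      ∑ S ∈ (Finset.Icc 1 K).powerset, (g S + g (insert (K + 1) S)) := by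
  have : Finset.Icc 1 (K + 1) = insert (K + 1) (Finset.Icc 1 K) := by
    ext m
    simp only [Finset.mem_Icc, Finset.mem_insert]
    omega
  rw [this, Finset.sum_powerset_insert (by simp), Finset.sum_add_distrib]

lemma alg_s (A B a b : ℂ) (h1 : A - a ≠ 0) (h2 : A - b ≠ 0) (h3 : B - a ≠ 0) (h4 : B - b ≠ 0) :
    (A - a)⁻¹ * (B - b)⁻¹ + (A - b)⁻¹ * (B - a)⁻¹ =
      (2 * A * B - (a + b) * (A + B) + 2 * a * b) * ((A - a) * (A - b) * (B - a) * (B - b))⁻¹ := by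
  field_simp
  ring

lemma alg_r (A B a b : ℂ) (h1 : A - a ≠ 0) (h2 : A - b ≠ 0) (h3 : B - a ≠ 0) (h4 : B - b ≠ 0)
    (h5 : a - b ≠ 0) :
    (a * (-(a - B)⁻¹ + 2 * (a - b)⁻¹) - A * (A - b)⁻¹) * ((A - a)⁻¹ * (B - b)⁻¹) +
    (b * (-(b - B)⁻¹ + 2 * (b - a)⁻¹) - A * (A - a)⁻¹) * ((A - b)⁻¹ * (B - a)⁻¹) = 0 := by
  rw [← neg_sub B a, ← neg_sub B b, ← neg_sub a b, inv_neg, inv_neg, inv_neg]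
  field_simp
  ring

lemma alg_q (A B a b : ℂ) (h1 : A - a ≠ 0) (h2 : A - b ≠ 0) (h3 : B - a ≠ 0) (h4 : B - b ≠ 0) :
    b * ((A - a)⁻¹ * (B - b)⁻¹) + a * ((A - b)⁻¹ * (B - a)⁻¹) =
      ((a + b) * A * B - 2 * a * b * (A + B) + a * b * (a + b)) *
        ((A - a) * (A - b) * (B - a) * (B - b))⁻¹
      - (a - b) ^ 2 * ((A - a) * (A - b) * (B - a) * (B - b))⁻¹ * B := by
  field_simp
  ring

lemma alg_r' (A B a b : ℂ) (h1 : A - a ≠ 0) (h2 : A - b ≠ 0) (h3 : B - a ≠ 0) (h4 : B - b ≠ 0)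
    (h5 : a - b ≠ 0) :
    (a * (-(a - B)⁻¹ + 2 * (a - b)⁻¹) - A * (A - b)⁻¹) * b * ((A - a)⁻¹ * (B - b)⁻¹) +
    (b * (-(b - B)⁻¹ + 2 * (b - a)⁻¹) - A * (A - a)⁻¹) * a * ((A - b)⁻¹ * (B - a)⁻¹) =
     - (((a + b) * A * B - 2 * a * b * (A + B) + a * b * (a + b)) *
        ((A - a) * (A - b) * (B - a) * (B - b))⁻¹) := by
  rw [← neg_sub B a, ← neg_sub B b, ← neg_sub a b, inv_neg, inv_neg, inv_neg]
  field_simp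
  ring

lemma swapOn_ne (L : ℕ) (t : ℕ → ℕ → ℂ)
    (hadj : ∀ m, 1 ≤ m → m ≤ L - 1 → ∀ a b, (a = 1 ∨ a = 2) → (b = 1 ∨ b = 2) →
      t (m - 1) a ≠ t m b) (S : Finset ℕ) (m : ℕ) (hm : m + 1 ≤ L - 1)
    (a b : ℕ) (ha : a = 1 ∨ a = 2) (hb : b = 1 ∨ b = 2) :
    swapOn S t m a - t (m + 1) b ≠ 0 := by
  have h1 := hadj (m + 1) (by omega) hm 1 b (by simp) hb
  have h2 := hadj (m + 1) (by omega) hm 2 b (by simp) hb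
  simp only [Nat.add_sub_cancel] at h1 h2
  rw [sub_ne_zero]
  rcases swapOn_or S t m with ⟨e1, e2⟩ | ⟨e1, e2⟩ <;> rcases ha with rfl | rfl <;>
    simp only [e1, e2] <;> assumption

lemma swapOn_ne' (L : ℕ) (t : ℕ → ℕ → ℂ)
    (hadj : ∀ m, 1 ≤ m → m ≤ L - 1 → ∀ a b, (a = 1 ∨ a = 2) → (b = 1 ∨ b = 2) →
      t (m - 1) a ≠ t m b) (S : Finset ℕ) (m : ℕ) (hm0 : 1 ≤ m) (hm : m ≤ L - 1)
    (a b : ℕ) (ha : a = 1 ∨ a = 2) (hb : b = 1 ∨ b = 2) :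
    swapOn S t (m - 1) a - swapOn S t m b ≠ 0 := by
  obtain ⟨k, rfl⟩ : ∃ k, m = k + 1 := ⟨m - 1, by omega⟩
  simp only [Nat.add_sub_cancel]
  have h1 := swapOn_ne L t hadj S k hm a 1 ha (by simp)
  have h2 := swapOn_ne L t hadj S k hm a 2 ha (by simp)
  rcases swapOn_or S t (k + 1) with ⟨e1, e2⟩ | ⟨e1, e2⟩ <;> rcases hb with rfl | rfl <;>
    simp only [e1, e2] <;> assumption

lemma main_ind (L : ℕ) (t : ℕ → ℕ → ℂ)
    (hadj : ∀ m, 1 ≤ m → m ≤ L - 1 → ∀ a b, (a = 1 ∨ a = 2) → (b = 1 ∨ b = 2) →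
      t (m - 1) a ≠ t m b)
    (hver : ∀ m, 1 ≤ m → m ≤ L - 1 → t m 1 ≠ t m 2) (n : ℕ) (hn : 1 ≤ n) (K : ℕ) (hK : n ≤ K) :
    K ≤ L - 1 →
    (∑ S ∈ (Finset.Icc 1 K).powerset, Cp n K (swapOn S t) * GG n K (swapOn S t) =
      ∑ S ∈ (Finset.Icc 1 K).powerset, GG n K (swapOn S t)) ∧
    (∑ S ∈ (Finset.Icc 1 K).powerset,
      Cp n K (swapOn S t) * swapOn S t K 2 * GG n K (swapOn S t) = 0) := by
  induction K, hK using Nat.le_induction with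
  | base =>
    intro hL
    obtain ⟨k, rfl⟩ : ∃ k, n = k + 1 := ⟨n - 1, by omega⟩
    rw [sum_split, sum_split, sum_split]
    have h5 : t (k + 1) 1 - t (k + 1) 2 ≠ 0 := sub_ne_zero.2 (hver _ hn hL)
    constructor
    · refine Finset.sum_congr rfl fun S hS => ?_
      obtain ⟨e0, e1, e2, e3, e4⟩ := swapOn_insert k S (Finset.mem_powerset.1 hS) t
      have h1 := swapOn_ne L t hadj S k hL 1 1 (by simp) (by simp)
      have h2 := swapOn_ne L t hadj S k hL 1 2 (by simp) (by simp)
      have h3 := swapOn_ne L t hadj S k hL 2 1 (by simp) (by simp)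
      have h4 := swapOn_ne L t hadj S k hL 2 2 (by simp) (by simp)
      unfold GG
      rw [Cp_self, Cp_self, PP_succ, PP_succ, PP_congr k _ _ e0]
      simp only [Nat.add_sub_cancel, e0 k le_rfl, e1, e2, e3, e4]
      generalize swapOn S t k 1 = A at *
      generalize swapOn S t k 2 = B at *
      generalize t (k + 1) 1 = a at *
      generalize t (k + 1) 2 = b at *
      rw [← neg_sub B a, ← neg_sub B b, ← neg_sub a b, inv_neg, inv_neg, inv_neg]
      field_simp
      ring
    · refine Finset.sum_eq_zero fun S hS => ?_
      obtain ⟨e0, e1, e2, e3, e4⟩ := swapOn_insert k S (Finset.mem_powerset.1 hS) t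
      have h1 := swapOn_ne L t hadj S k hL 1 1 (by simp) (by simp)
      have h2 := swapOn_ne L t hadj S k hL 1 2 (by simp) (by simp)
      have h3 := swapOn_ne L t hadj S k hL 2 1 (by simp) (by simp)
      have h4 := swapOn_ne L t hadj S k hL 2 2 (by simp) (by simp)
      unfold GG
      rw [Cp_self, Cp_self, PP_succ, PP_succ, PP_congr k _ _ e0]
      simp only [Nat.add_sub_cancel, e0 k le_rfl, e1, e2, e3, e4]
      generalize swapOn S t k 1 = A at *
      generalize swapOn S t k 2 = B at *
      generalize t (k + 1) 1 = a at *
      generalize t (k + 1) 2 = b at *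
      rw [← neg_sub B a, ← neg_sub B b, ← neg_sub a b, inv_neg, inv_neg, inv_neg]
      field_simp
      ring
  | succ K hK ih =>
    intro hL
    obtain ⟨ih1, ih2⟩ := ih (by omega)
    rw [sum_split, sum_split, sum_split]
    have h5 : t (K + 1) 1 - t (K + 1) 2 ≠ 0 := sub_ne_zero.2 (hver _ (by omega) hL)
    set D : ℂ := ((t K 1 - t (K + 1) 1) * (t K 1 - t (K + 1) 2) * (t K 2 - t (K + 1) 1) *
      (t K 2 - t (K + 1) 2))⁻¹ with hD
    set s : ℂ := (2 * t K 1 * t K 2 - (t (K + 1) 1 + t (K + 1) 2) * (t K 1 + t K 2)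
      + 2 * t (K + 1) 1 * t (K + 1) 2) * D with hs
    set σ : ℂ := ((t (K + 1) 1 + t (K + 1) 2) * t K 1 * t K 2
      - 2 * t (K + 1) 1 * t (K + 1) 2 * (t K 1 + t K 2)
      + t (K + 1) 1 * t (K + 1) 2 * (t (K + 1) 1 + t (K + 1) 2)) * D with hσ
    set τ : ℂ := (t (K + 1) 1 - t (K + 1) 2) ^ 2 * D with hτ
    have key : ∀ S ∈ (Finset.Icc 1 K).powerset,
        (Cp n (K + 1) (swapOn S t) * GG n (K + 1) (swapOn S t) +
          Cp n (K + 1) (swapOn (insert (K + 1) S) t) * GG n (K + 1) (swapOn (insert (K + 1) S) t)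
          = s * (Cp n K (swapOn S t) * GG n K (swapOn S t))) ∧
        (GG n (K + 1) (swapOn S t) + GG n (K + 1) (swapOn (insert (K + 1) S) t)
          = s * GG n K (swapOn S t)) ∧
        (Cp n (K + 1) (swapOn S t) * swapOn S t (K + 1) 2 * GG n (K + 1) (swapOn S t) +
          Cp n (K + 1) (swapOn (insert (K + 1) S) t) * swapOn (insert (K + 1) S) t (K + 1) 2 *
            GG n (K + 1) (swapOn (insert (K + 1) S) t)
          = σ * (Cp n K (swapOn S t) * GG n K (swapOn S t))
            - τ * (Cp n K (swapOn S t) * swapOn S t K 2 * GG n K (swapOn S t))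
            - σ * GG n K (swapOn S t)) := by
      intro S hS
      obtain ⟨e0, e1, e2, e3, e4⟩ := swapOn_insert K S (Finset.mem_powerset.1 hS) t
      have h1 := swapOn_ne L t hadj S K hL 1 1 (by simp) (by simp)
      have h2 := swapOn_ne L t hadj S K hL 1 2 (by simp) (by simp)
      have h3 := swapOn_ne L t hadj S K hL 2 1 (by simp) (by simp)
      have h4 := swapOn_ne L t hadj S K hL 2 2 (by simp) (by simp)
      rw [Cp_succ n K hK, Cp_succ n K hK, GG_succ, GG_succ, GG_congr n K hK _ _ e0,
        Cp_congr n K _ _ e0]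
      simp only [e0 K le_rfl, e1, e2, e3, e4]
      have k1 := alg_s _ _ _ _ h1 h2 h3 h4
      have k2 := alg_r _ _ _ _ h1 h2 h3 h4 h5
      have k3 := alg_q _ _ _ _ h1 h2 h3 h4
      have k4 := alg_r' _ _ _ _ h1 h2 h3 h4 h5
      have hD' : ((swapOn S t K 1 - t (K + 1) 1) * (swapOn S t K 1 - t (K + 1) 2) *
          (swapOn S t K 2 - t (K + 1) 1) * (swapOn S t K 2 - t (K + 1) 2))⁻¹ = D := by
        rcases swapOn_or S t K with ⟨q1, q2⟩ | ⟨q1, q2⟩ <;> rw [q1, q2, hD]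
        congr 1
        ring
      rw [hD'] at k1 k3 k4
      have hs' : (2 * swapOn S t K 1 * swapOn S t K 2
          - (t (K + 1) 1 + t (K + 1) 2) * (swapOn S t K 1 + swapOn S t K 2)
          + 2 * t (K + 1) 1 * t (K + 1) 2) * D = s := by
        rcases swapOn_or S t K with ⟨q1, q2⟩ | ⟨q1, q2⟩ <;> rw [q1, q2, hs] <;> ring
      have hσ' : ((t (K + 1) 1 + t (K + 1) 2) * swapOn S t K 1 * swapOn S t K 2
          - 2 * t (K + 1) 1 * t (K + 1) 2 * (swapOn S t K 1 + swapOn S t K 2)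
          + t (K + 1) 1 * t (K + 1) 2 * (t (K + 1) 1 + t (K + 1) 2)) * D = σ := by
        rcases swapOn_or S t K with ⟨q1, q2⟩ | ⟨q1, q2⟩ <;> rw [q1, q2, hσ] <;> ring
      rw [hs'] at k1
      rw [hσ', ← hτ] at k3
      rw [hσ'] at k4
      generalize Cp n K (swapOn S t) = C at *
      generalize GG n K (swapOn S t) = G at *
      refine ⟨?_, ?_, ?_⟩
      · linear_combination (C * G) * k1 + G * k2
      · linear_combination G * k1
      · linear_combination (C * G) * k3 + G * k4
    constructor
    · rw [Finset.sum_congr rfl fun S hS => (key S hS).1,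
        Finset.sum_congr rfl fun S hS => (key S hS).2.1, ← Finset.mul_sum, ← Finset.mul_sum, ih1]
    · rw [Finset.sum_congr rfl fun S hS => (key S hS).2.2, Finset.sum_sub_distrib,
        Finset.sum_sub_distrib, ← Finset.mul_sum, ← Finset.mul_sum, ← Finset.mul_sum, ih1, ih2]
      ring

lemma fP_eq (L : ℕ) (v : ℂ) (n : ℕ) (hn : n ∈ Finset.Icc 1 (L - 1)) (u : ℕ → ℕ → ℂ) (a : ℕ)
    (h : u (n - 1) a - u n a ≠ 0) :
    fP L v n u a = (1 - v * u (L - 1) a)⁻¹ * ((u (n - 1) a - u n a) * f0 L u a) := by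
  unfold fP f0
  rw [← Finset.mul_prod_erase _ _ hn, mul_inv_cancel_left₀ h]

lemma tele (u : ℕ → ℂ) (p K : ℕ) (h : p ≤ K) :
    ∑ m ∈ Finset.Icc (p + 1) K, (u (m - 1) - u m) = u p - u K := by
  induction K, h using Nat.le_induction with
  | base => simp
  | succ K hK ih =>
    rw [Finset.sum_Icc_succ_top (by omega), ih]
    simp

lemma sum_fP (L : ℕ) (v : ℂ) (p : ℕ) (hp : p ≤ L - 1) (u : ℕ → ℕ → ℂ) (a : ℕ)
    (h : ∀ m, 1 ≤ m → m ≤ L - 1 → u (m - 1) a - u m a ≠ 0) :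
    ∑ m ∈ Finset.Icc (p + 1) (L - 1), fP L v m u a =
      (1 - v * u (L - 1) a)⁻¹ * ((u p a - u (L - 1) a) * f0 L u a) := by
  rw [← tele (fun m => u m a) p (L - 1) hp, Finset.sum_mul, Finset.mul_sum]
  refine Finset.sum_congr rfl fun m hm => ?_
  rw [Finset.mem_Icc] at hm
  rw [fP_eq L v m (Finset.mem_Icc.2 ⟨by omega, hm.2⟩) u a (h m (by omega) hm.2)]

theorem stmt15 (L : ℕ) (hL : 2 ≤ L) (t : ℕ → ℕ → ℂ) (x y : ℂ)
    (ht01 : t 0 1 = 1) (ht02 : t 0 2 = 1)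
    (hadj : ∀ m, 1 ≤ m → m ≤ L - 1 → ∀ a b, (a = 1 ∨ a = 2) → (b = 1 ∨ b = 2) →
      t (m - 1) a ≠ t m b)
    (hver : ∀ m, 1 ≤ m → m ≤ L - 1 → t m 1 ≠ t m 2)
    (hxt : ∀ a, (a = 1 ∨ a = 2) → 1 - x * t (L - 1) a ≠ 0)
    (hyt : ∀ a, (a = 1 ∨ a = 2) → 1 - y * t (L - 1) a ≠ 0)
    (htL1 : t (L - 1) 1 ≠ 0) (htL2 : t (L - 1) 2 ≠ 0)
    (hxy : x ≠ y) (hx1 : x ≠ 1) :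
    -- Statement 15 (Lemma `l = 0`).
    ∀ n, 1 ≤ n → n ≤ L - 1 →
      symSum L t (fun u => Cf L n u * ((u (L - 1) 1)⁻¹ * fP L x n u 1) *
          ((u (L - 1) 2)⁻¹ * f0 L u 2))
        = symSum L t (fun u => ((x - 1) * u (L - 1) 1 * u (L - 1) 2)⁻¹ *
            (fP L x n u 1 *
              (-((1 + (if n = 1 then (1 : ℂ) else 0)) * f0 L u 2)
                + x * ∑ m ∈ Finset.Icc 1 (L - 1), fP L x m u 2)))
          + (if n = 1 then (1 : ℂ) else 0) *
            symSum L t (fun u => ((x - 1) * u (L - 1) 1 * u (L - 1) 2)⁻¹ *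
              (f0 L u 2 *
                (f0 L u 1 - x * ∑ m ∈ Finset.Icc 2 (L - 1), fP L x m u 1))) := by
  intro n hn1 hn2
  obtain ⟨I1, I2⟩ := main_ind L t hadj hver n hn1 (L - 1) hn2 le_rfl
  set c : ℂ := (t (L - 1) 1 * t (L - 1) 2)⁻¹ *
    ((1 - x * t (L - 1) 1) * (1 - x * t (L - 1) 2))⁻¹ with hc
  have hx1' : x - 1 ≠ 0 := sub_ne_zero.2 hx1
  rw [← sub_eq_zero]
  have fin : c * (∑ S ∈ (Finset.Icc 1 (L - 1)).powerset,
        Cp n (L - 1) (swapOn S t) * GG n (L - 1) (swapOn S t)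
      - x * ∑ S ∈ (Finset.Icc 1 (L - 1)).powerset,
        Cp n (L - 1) (swapOn S t) * swapOn S t (L - 1) 2 * GG n (L - 1) (swapOn S t)
      - ∑ S ∈ (Finset.Icc 1 (L - 1)).powerset, GG n (L - 1) (swapOn S t)) = 0 := by
    rw [I1, I2]
    ring
  refine Eq.trans ?_ fin
  unfold symSum
  rw [← sub_sub, Finset.mul_sum, Finset.mul_sum, ← Finset.sum_sub_distrib,
    ← Finset.sum_sub_distrib, ← Finset.sum_sub_distrib, ← Finset.sum_sub_distrib, Finset.mul_sum]
  refine Finset.sum_congr rfl fun S hS => ?_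
  have hne := fun m h1 h2 a ha => swapOn_ne' L t hadj S m h1 h2 a a ha ha
  have hu0 : swapOn S t 0 1 = 1 ∧ swapOn S t 0 2 = 1 := by
    rcases swapOn_or S t 0 with ⟨q1, q2⟩ | ⟨q1, q2⟩ <;> rw [q1, q2, ht01, ht02] <;> simp
  have hz : swapOn S t (L - 1) 1 ≠ 0 ∧ swapOn S t (L - 1) 2 ≠ 0 ∧
      1 - x * swapOn S t (L - 1) 1 ≠ 0 ∧ 1 - x * swapOn S t (L - 1) 2 ≠ 0 := by
    have k1 := hxt 1 (by simp)
    have k2 := hxt 2 (by simp)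
    rcases swapOn_or S t (L - 1) with ⟨q1, q2⟩ | ⟨q1, q2⟩ <;> rw [q1, q2] <;>
      refine ⟨?_, ?_, ?_, ?_⟩ <;> assumption
  have hc' : c = (swapOn S t (L - 1) 1 * swapOn S t (L - 1) 2)⁻¹ *
      ((1 - x * swapOn S t (L - 1) 1) * (1 - x * swapOn S t (L - 1) 2))⁻¹ := by
    rcases swapOn_or S t (L - 1) with ⟨q1, q2⟩ | ⟨q1, q2⟩ <;> rw [q1, q2, hc]
    congr 2 <;> ring
  rw [hc']
  clear hc' hc c fin I1 I2
  generalize swapOn S t = u at *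
  have hPP : PP (L - 1) u = f0 L u 1 * f0 L u 2 := by
    unfold PP f0
    rw [Finset.prod_mul_distrib]
  have hCf : Cf L n u = Cp n (L - 1) u + (if n = 1 then u 1 1 * (u 1 1 - 1)⁻¹ else 0) := by
    have : Finset.Icc n (L - 2) = Finset.Ico n (L - 1) := by
      ext m
      simp only [Finset.mem_Icc, Finset.mem_Ico]
      omega
    unfold Cf Cp
    rw [this]
  have s1 := sum_fP L x 0 (by omega) u 2 (fun m h1 h2 => hne m h1 h2 2 (by simp))
  have s2 := sum_fP L x 1 (by omega) u 1 (fun m h1 h2 => hne m h1 h2 1 (by simp))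
  simp only [zero_add, Nat.reduceAdd] at s1 s2
  have hn' := hne n hn1 hn2 1 (by simp)
  beta_reduce
  rw [hCf, s1, s2, fP_eq L x n (Finset.mem_Icc.2 ⟨hn1, hn2⟩) u 1 hn', GG, hPP, hu0.2]
  obtain ⟨z1, z2, z3, z4⟩ := hz
  generalize Cp n (L - 1) u = C
  generalize f0 L u 1 = F
  generalize f0 L u 2 = G
  by_cases h : n = 1
  · subst h
    simp only [Nat.sub_self, if_true, hu0.1] at hn' ⊢
    generalize u (L - 1) 1 = a at *
    generalize u (L - 1) 2 = b at *
    generalize u 1 1 = a1 at *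
    rw [← neg_sub 1 a1, inv_neg]
    have z3' : 1 - a * x ≠ 0 := by rwa [mul_comm]
    have z4' : 1 - b * x ≠ 0 := by rwa [mul_comm]
    field_simp
    ring
  · simp only [if_neg h]
    generalize u (L - 1) 1 = a at *
    generalize u (L - 1) 2 = b at *
    generalize u n 1 = a1 at *
    field_simp
    ring
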